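/- Let p, K be positive integers with K ≤ p and let Z₁, Z₂ ∈ ℂ^{p×K} both have full column rank K. If Z₁Z₁^⊤ = Z₂Z₂^⊤ and Z₁Z₁^H = Z₂Z₂^H, then there exists a real orthogonal matrix O ∈ ℝ^{K×K} such that Z₂ = Z₁O. (Uniqueness part of Theorem 3.1: two full-column-rank factors producing the same symmetric Gram matrix ZZ^⊤ and the same Hermitian Gram matrix ZZ^H differ by right multiplication with a real orthogonal matrix.) -/

import Mathlib

open Matrix

theorem aux_left_inv (p K : ℕ) (Z : Matrix (Fin p) (Fin K) ℂ) (h : Z.rank = K) :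
    ∃ L : Matrix (Fin K) (Fin p) ℂ, L * Z = 1 := by
  have hr : (Zᴴ * Z).rank = K := by
    open scoped ComplexOrder in
    rw [rank_conjTranspose_mul_self, h]
  have hu : IsUnit (Zᴴ * Z) := by
    rw [← mulVec_surjective_iff_isUnit]
    have : LinearMap.range (Zᴴ * Z).mulVecLin = ⊤ := by
      apply Submodule.eq_top_of_finrank_eq
      rw [← Matrix.rank, hr]
      simp
    exact LinearMap.range_eq_top.mp this
  refine ⟨(Zᴴ * Z)⁻¹ * Zᴴ, ?_⟩
  rw [Matrix.mul_assoc]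
  exact Matrix.nonsing_inv_mul _ ((Matrix.isUnit_iff_isUnit_det _).mp hu)

/-- Uniqueness part of Theorem 3.1: two full-column-rank factors producing the same
symmetric Gram matrix `Z Zᵀ` and the same Hermitian Gram matrix `Z Zᴴ` differ by right
multiplication with a real orthogonal matrix. -/
theorem stmt0 (p K : ℕ) (hp : 0 < p) (hK : 0 < K) (hKp : K ≤ p)
    (Z₁ Z₂ : Matrix (Fin p) (Fin K) ℂ)
    (h₁ : Z₁.rank = K) (h₂ : Z₂.rank = K)
    (hT : Z₁ * Z₁ᵀ = Z₂ * Z₂ᵀ) (hH : Z₁ * Z₁ᴴ = Z₂ * Z₂ᴴ) :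
    ∃ O : Matrix (Fin K) (Fin K) ℝ,
      O * Oᵀ = 1 ∧ Oᵀ * O = 1 ∧ Z₂ = Z₁ * O.map Complex.ofReal := by
  obtain ⟨L₁, hL₁⟩ := aux_left_inv p K Z₁ h₁
  obtain ⟨L₂, hL₂⟩ := aux_left_inv p K Z₂ h₂
  obtain ⟨Q, hQ⟩ : ∃ Q : Matrix (Fin K) (Fin K) ℂ, Z₂ = Z₁ * Q := by
    refine ⟨Z₁ᴴ * L₂ᴴ, ?_⟩
    rw [← Matrix.mul_assoc, hH, Matrix.mul_assoc, ← conjTranspose_mul, hL₂]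
    simp
  have hQH : Q * Qᴴ = 1 := by
    have h := congrArg (fun M => L₁ * M * L₁ᴴ) hH
    have e1 : L₁ * (Z₁ * Z₁ᴴ) * L₁ᴴ = (L₁ * Z₁) * (L₁ * Z₁)ᴴ := by
      simp only [conjTranspose_mul, Matrix.mul_assoc]
    have e2 : L₁ * (Z₂ * Z₂ᴴ) * L₁ᴴ = (L₁ * Z₁) * (Q * Qᴴ) * (L₁ * Z₁)ᴴ := by
      rw [hQ]; simp only [conjTranspose_mul, Matrix.mul_assoc]
    simp only [e1, e2, hL₁] at h
    simpa using h.symm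
  have hQT : Q * Qᵀ = 1 := by
    have h := congrArg (fun M => L₁ * M * L₁ᵀ) hT
    have e1 : L₁ * (Z₁ * Z₁ᵀ) * L₁ᵀ = (L₁ * Z₁) * (L₁ * Z₁)ᵀ := by
      simp only [transpose_mul, Matrix.mul_assoc]
    have e2 : L₁ * (Z₂ * Z₂ᵀ) * L₁ᵀ = (L₁ * Z₁) * (Q * Qᵀ) * (L₁ * Z₁)ᵀ := by
      rw [hQ]; simp only [transpose_mul, Matrix.mul_assoc]
    simp only [e1, e2, hL₁] at h
    simpa using h.symm
  have hE : Qᴴ = Qᵀ := by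
    have h3 : Qᵀ * Q = 1 := mul_eq_one_comm.mp hQT
    calc Qᴴ = (Qᵀ * Q) * Qᴴ := by rw [h3, Matrix.one_mul]
      _ = Qᵀ := by rw [Matrix.mul_assoc, hQH, Matrix.mul_one]
  have hR : (Q.map Complex.re).map Complex.ofReal = Q := by
    ext i j
    have h := congrFun (congrFun hE j) i
    simp only [conjTranspose_apply, transpose_apply] at h
    exact Complex.conj_eq_iff_re.mp h
  have hO : Q.map Complex.re * (Q.map Complex.re)ᵀ = 1 := by
    apply Matrix.map_injective Complex.ofReal_injective
    change (_ : Matrix _ _ ℝ).map Complex.ofRealHom = (1 : Matrix _ _ ℝ).map Complex.ofRealHom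
    rw [Matrix.map_mul, ← transpose_map]
    change (Q.map Complex.re).map Complex.ofReal * ((Q.map Complex.re).map Complex.ofReal)ᵀ = _
    rw [hR, hQT]
    simp
  exact ⟨Q.map Complex.re, hO, mul_eq_one_comm.mp hO, by rw [hR, hQ]⟩
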